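/- arXiv:2310.12275 — 6 statements merged into one kernel-verified Lean document; each statement's English description precedes it below -/
import Mathlib

section
/- Let t be real with 0 < t < 1, let δ > 0, and let z ∈ ℂ satisfy |Re(z) − t^{−i}| > δ t^{−i} for every integer i. Then for every n ∈ ℤ_{≥1} and also for n = ∞, |(z;t)_n| ≥ δ (t^{1/2};t)_∞^2. -/
open scoped BigOperators

/-- `(t^{1/2};t)_∞ = ∏_{i≥0} (1 - t^{1/2} t^i)`. -/
noncomputable def sqrtPochInf (t : ℝ) : ℝ := ∏' i : ℕ, (1 - Real.sqrt t * t ^ i)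

lemma aux_q (t : ℝ) (ht0 : 0 < t) (ht1 : t < 1) (m : ℕ) :
    0 < Real.sqrt t * t ^ m ∧ Real.sqrt t * t ^ m < 1 := by
  have h1 : 0 < Real.sqrt t := Real.sqrt_pos.2 ht0
  have h2 : Real.sqrt t < 1 := by
    rw [Real.sqrt_lt' one_pos]; simpa using ht1
  have h3 : 0 < t ^ m := pow_pos ht0 m
  have h4 : t ^ m ≤ 1 := pow_le_one₀ ht0.le ht1.le
  exact ⟨by positivity, by nlinarith⟩

lemma aux_hasProd (t : ℝ) (ht0 : 0 < t) (ht1 : t < 1) :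
    HasProd (fun i : ℕ => (1 - Real.sqrt t * t ^ i)) (sqrtPochInf t) := by
  have h : Multipliable (fun i : ℕ => (1 + (-(Real.sqrt t * t ^ i)))) := by
    apply Real.multipliable_one_add_of_summable
    exact ((summable_geometric_of_lt_one ht0.le ht1).mul_left _).neg
  simpa [sub_eq_add_neg, sqrtPochInf] using h.hasProd

lemma aux_nonneg (t : ℝ) (ht0 : 0 < t) (ht1 : t < 1) : 0 ≤ sqrtPochInf t := by
  refine ge_of_tendsto (aux_hasProd t ht0 ht1) (Filter.Eventually.of_forall fun S => ?_)
  exact Finset.prod_nonneg fun i _ => by linarith [(aux_q t ht0 ht1 i).2]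

lemma aux_le (t : ℝ) (ht0 : 0 < t) (ht1 : t < 1) (S : Finset ℕ) :
    sqrtPochInf t ≤ ∏ i ∈ S, (1 - Real.sqrt t * t ^ i) := by
  refine le_of_tendsto (aux_hasProd t ht0 ht1)
    ((Filter.eventually_ge_atTop S).mono fun T hT => ?_)
  rw [← Finset.prod_sdiff hT]
  refine mul_le_of_le_one_left (Finset.prod_nonneg fun i _ => ?_)
    (Finset.prod_le_one (fun i _ => ?_) fun i _ => ?_)
  all_goals linarith [(aux_q t ht0 ht1 i).2, (aux_q t ht0 ht1 i).1]

lemma aux_le' (t : ℝ) (ht0 : 0 < t) (ht1 : t < 1) (S : Finset ℕ) (e : ℕ → ℕ)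
    (he : Set.InjOn e S) (f : ℕ → ℝ)
    (hf : ∀ i ∈ S, 1 - Real.sqrt t * t ^ (e i) ≤ f i) :
    sqrtPochInf t ≤ ∏ i ∈ S, f i := by
  refine (aux_le t ht0 ht1 (S.image e)).trans ?_
  rw [Finset.prod_image he]
  exact Finset.prod_le_prod (fun i _ => by linarith [(aux_q t ht0 ht1 (e i)).2]) hf

lemma aux_main (t : ℝ) (ht0 : 0 < t) (ht1 : t < 1) (δ : ℝ) (hδ : 0 < δ) (x : ℝ)
    (hx : ∀ i : ℕ, δ ≤ |1 - x * t ^ i|) (n : ℕ) :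
    δ * (sqrtPochInf t) ^ 2 ≤ ∏ i ∈ Finset.range n, |1 - x * t ^ i| := by
  have hP0 := aux_nonneg t ht0 ht1
  have hP1 : sqrtPochInf t ≤ 1 := by simpa using aux_le t ht0 ht1 ∅
  have hδ1 : δ ≤ 1 := by
    have h : Filter.Tendsto (fun i : ℕ => |1 - x * t ^ i|) Filter.atTop (nhds |1 - x * 0|) :=
      ((tendsto_pow_atTop_nhds_zero_of_lt_one ht0.le ht1).const_mul x |>.const_sub 1).abs
    simpa using ge_of_tendsto h (Filter.Eventually.of_forall hx)
  rcases le_or_gt x 0 with hx0 | hx0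
  · have h1 : (1:ℝ) ≤ ∏ i ∈ Finset.range n, |1 - x * t ^ i| := by
      have : ∏ i ∈ Finset.range n, (1:ℝ) ≤ ∏ i ∈ Finset.range n, |1 - x * t ^ i| :=
        Finset.prod_le_prod (fun _ _ => zero_le_one) fun i _ =>
          le_trans (by nlinarith [pow_pos ht0 i]) (le_abs_self _)
      simpa using this
    have h2 : sqrtPochInf t ^ 2 ≤ 1 := pow_le_one₀ hP0 hP1
    nlinarith [sq_nonneg (sqrtPochInf t)]
  have hs0 : 0 < Real.sqrt t := Real.sqrt_pos.2 ht0
  have hss : Real.sqrt t * Real.sqrt t = t := Real.mul_self_sqrt ht0.le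
  obtain ⟨k, hk1, hk2⟩ := exists_mem_Ico_zpow (div_pos hx0 hs0) ((one_lt_inv₀ ht0).2 ht1)
  set s := Real.sqrt t with hs
  have hkp : 0 < t ^ k := zpow_pos ht0 k
  obtain ⟨u, hu⟩ : ∃ u, u = x * t ^ k := ⟨_, rfl⟩
  have hu1 : s ≤ u := by
    rw [inv_zpow, le_div_iff₀ hs0, inv_mul_le_iff₀ hkp] at hk1
    rw [hu]; linarith
  have hu2 : u * s ≤ 1 := by
    rw [inv_zpow, div_lt_iff₀ hs0, lt_inv_mul_iff₀ (zpow_pos ht0 _), zpow_add_one₀ ht0.ne'] at hk2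
    have : (u * s) * s < 1 * s := by
      have : u * s * s = t ^ k * t * x := by rw [hu, mul_assoc, hss]; ring
      linarith
    exact (lt_of_mul_lt_mul_right this hs0.le).le
  have hxu : ∀ i : ℕ, x * t ^ i = u * t ^ ((i : ℤ) - k) := by
    intro i
    rw [hu, zpow_sub₀ ht0.ne', zpow_natCast]
    field_simp
  have hhi : ∀ (i : ℕ), k < i → 1 - s * t ^ ((i : ℤ) - k - 1).toNat ≤ |1 - x * t ^ i| := by
    intro i hi
    obtain ⟨m, hm⟩ : ∃ m : ℕ, (i : ℤ) - k = m + 1 := ⟨((i : ℤ) - k - 1).toNat, by omega⟩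
    have h1 : ((i : ℤ) - k - 1).toNat = m := by omega
    rw [h1, hxu, hm]
    have h2 : t ^ ((m : ℤ) + 1) = s * (s * t ^ m) := by
      rw [zpow_add_one₀ ht0.ne', zpow_natCast, ← mul_assoc, hss]; ring
    rw [h2]
    refine le_trans ?_ (le_abs_self _)
    have := (aux_q t ht0 ht1 m).1
    nlinarith
  have hlo : ∀ (i : ℕ), (i : ℤ) < k → 1 - s * t ^ (k - (i : ℤ) - 1).toNat ≤ |1 - x * t ^ i| := by
    intro i hi
    obtain ⟨m, hm⟩ : ∃ m : ℕ, (i : ℤ) - k = -((m:ℤ) + 1) := ⟨(k - (i : ℤ) - 1).toNat, by omega⟩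
    have h1 : (k - (i : ℤ) - 1).toNat = m := by omega
    rw [h1, hxu, hm]
    have h2 : t ^ (-((m : ℤ) + 1)) * (s * (s * t ^ m)) = 1 := by
      rw [zpow_neg, zpow_add_one₀ ht0.ne', zpow_natCast, ← mul_assoc s s, hss]
      field_simp
    have hv : 0 < t ^ (-((m : ℤ) + 1)) := zpow_pos ht0 _
    generalize t ^ (-((m : ℤ) + 1)) = v at *
    have h3 := (aux_q t ht0 ht1 m).1
    rw [← hs] at h3
    generalize s * t ^ m = q at *
    rw [abs_sub_comm]
    refine le_trans ?_ (le_abs_self _)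
    have h4 : 1 ≤ (u * v) * q := by
      calc (1:ℝ) = s * (v * q) := by linarith
        _ ≤ u * (v * q) := by gcongr
        _ = _ := by ring
    have h5 : 0 < u * v := mul_pos (hs0.trans_le hu1) hv
    nlinarith [sq_nonneg (u * v - q)]
  have hA := aux_le' t ht0 ht1 ((Finset.range n).filter fun i : ℕ => (i : ℤ) < k)
    (fun i => (k - (i : ℤ) - 1).toNat)
    (by intro a ha b hb hab; simp at ha hb hab; omega) (fun i => |1 - x * t ^ i|)
    (by intro i hi; exact hlo i (Finset.mem_filter.1 hi).2)
  have hB := aux_le' t ht0 ht1 ((Finset.range n).filter fun i : ℕ => k < (i : ℤ))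
    (fun i => ((i : ℤ) - k - 1).toNat)
    (by intro a ha b hb hab; simp at ha hb hab; omega) (fun i => |1 - x * t ^ i|)
    (by intro i hi; exact hhi i (Finset.mem_filter.1 hi).2)
  have hC : δ ≤ ∏ i ∈ (Finset.range n).filter (fun i : ℕ => (i : ℤ) = k), |1 - x * t ^ i| := by
    by_cases h : ∃ j ∈ Finset.range n, (j : ℤ) = k
    · obtain ⟨j, hj, hjk⟩ := h
      have : (Finset.range n).filter (fun i : ℕ => (i : ℤ) = k) = {j} := by
        ext a; simp at hj ⊢; omega
      rw [this, Finset.prod_singleton]; exact hx j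
    · have : (Finset.range n).filter (fun i : ℕ => (i : ℤ) = k) = ∅ := by
        rw [Finset.filter_eq_empty_iff]; intro a ha hak; exact h ⟨a, ha, hak⟩
      rw [this]; simpa using hδ1
  have hsplit : ∏ i ∈ Finset.range n, |1 - x * t ^ i| =
      (∏ i ∈ (Finset.range n).filter (fun i : ℕ => (i : ℤ) = k), |1 - x * t ^ i|) *
      ((∏ i ∈ (Finset.range n).filter (fun i : ℕ => (i : ℤ) < k), |1 - x * t ^ i|) *
      (∏ i ∈ (Finset.range n).filter (fun i : ℕ => k < (i : ℤ)), |1 - x * t ^ i|)) := by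
    rw [Finset.prod_filter, Finset.prod_filter, Finset.prod_filter, ← Finset.prod_mul_distrib,
      ← Finset.prod_mul_distrib]
    refine Finset.prod_congr rfl fun i _ => ?_
    rcases lt_trichotomy (i : ℤ) k with h | h | h
    · simp [h, h.ne, h.not_gt]
    · simp [h]
    · simp [h, h.ne', h.not_gt]
  rw [hsplit, pow_two]
  gcongr

theorem stmt7 (t : ℝ) (ht0 : 0 < t) (ht1 : t < 1) (δ : ℝ) (hδ : 0 < δ) (z : ℂ)
    (hz : ∀ i : ℤ, δ * t ^ (-i) < |z.re - t ^ (-i)|) :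
    (∀ n : ℕ, 1 ≤ n →
      δ * (sqrtPochInf t) ^ 2 ≤ ‖∏ i ∈ Finset.range n, (1 - z * (t : ℂ) ^ i)‖) ∧
    δ * (sqrtPochInf t) ^ 2 ≤ ‖∏' i : ℕ, (1 - z * (t : ℂ) ^ i)‖ := by
  have hx : ∀ i : ℕ, δ ≤ |1 - z.re * t ^ i| := by
    intro i
    have h := hz i
    have hp : 0 < t ^ i := pow_pos ht0 i
    rw [zpow_neg, zpow_natCast] at h
    have h1 : |1 - z.re * t ^ i| = |z.re - (t ^ i)⁻¹| * t ^ i := by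
      rw [abs_sub_comm, ← abs_of_pos hp, ← abs_mul, abs_of_pos hp]
      congr 1; field_simp
    rw [h1]
    rw [← div_eq_mul_inv, div_lt_iff₀ hp] at h
    exact h.le
  have key : ∀ n : ℕ,
      δ * (sqrtPochInf t) ^ 2 ≤ ‖∏ i ∈ Finset.range n, (1 - z * (t : ℂ) ^ i)‖ := by
    intro n
    refine (aux_main t ht0 ht1 δ hδ z.re hx n).trans ?_
    rw [norm_prod]
    refine Finset.prod_le_prod (fun _ _ => abs_nonneg _) fun i _ => ?_
    have := Complex.abs_re_le_norm (1 - z * (t : ℂ) ^ i)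
    have h2 : (1 - z * (t : ℂ) ^ i).re = 1 - z.re * t ^ i := by
      rw [← Complex.ofReal_pow, Complex.sub_re, Complex.re_mul_ofReal, Complex.one_re]
    rwa [h2] at this
  refine ⟨fun n _ => key n, ?_⟩
  have hm : Multipliable (fun i : ℕ => (1 + (-(z * (t : ℂ) ^ i)))) := by
    apply Complex.multipliable_one_add_of_summable
    have hg : Summable (fun i : ℕ => (t : ℂ) ^ i) :=
      summable_geometric_of_norm_lt_one (by simpa [abs_of_pos ht0] using ht1)
    exact (hg.mul_left z).neg
  simp only [← sub_eq_add_neg] at hm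
  exact ge_of_tendsto hm.hasProd.tendsto_prod_nat.norm (Filter.Eventually.of_forall key)
end

section
/- For every real t with 0 < t < 1 there exists a constant C > 0 such that for every n ∈ ℤ_{≥1} ∪ {∞} and every point w of the set tG, one has |(−tw;t)_n| ≥ 1/C (equivalently, |1/(−tw;t)_n| ≤ C). -/
open scoped BigOperators

/-- The contour set `tG ⊂ ℂ`: two horizontal rays at heights `±1` with nonpositive real part,
together with the right half of the unit circle. -/
def tGSet : Set ℂ :=
  {z | (z.im = 1 ∧ z.re ≤ 0) ∨ (z.im = -1 ∧ z.re ≤ 0) ∨ (‖z‖ = 1 ∧ 0 < z.re)}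

/-- The norm of the finite product. -/
noncomputable def ff (t : ℝ) (n : ℕ) (w : ℂ) : ℝ :=
  ∏ i ∈ Finset.range n, ‖1 + (t : ℂ) ^ (i + 1) * w‖

theorem ff_zero (t : ℝ) (w : ℂ) : ff t 0 w = 1 := by simp [ff]

theorem ff_succ (t : ℝ) (n : ℕ) (w : ℂ) :
    ff t (n + 1) w = ‖1 + (t : ℂ) * w‖ * ff t n (t * w) := by
  unfold ff
  rw [Finset.prod_range_succ', mul_comm]
  congr 1
  · simp
  · refine Finset.prod_congr rfl fun i _ => ?_
    congr 2
    ring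

theorem ff_nonneg (t : ℝ) (n : ℕ) (w : ℂ) : 0 ≤ ff t n w :=
  Finset.prod_nonneg fun _ _ => norm_nonneg _

theorem ff_base (t : ℝ) (ht0 : 0 < t) (ht1 : t < 1) :
    ∃ c : ℝ, 0 < c ∧ c ≤ 1 ∧ ∀ n w, -w.re ≤ 1 → c ≤ ff t n w := by
  have h1 : 0 < 1 - t := by linarith
  refine ⟨Real.exp (-(1 / (1 - t) / (1 - t))), Real.exp_pos _, ?_, ?_⟩
  · rw [Real.exp_le_one_iff]
    have : 0 < 1 / (1 - t) / (1 - t) := by positivity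
    linarith
  intro n w hw
  have key : ∀ i : ℕ, Real.exp (-(t ^ i / (1 - t))) ≤ ‖1 + (t : ℂ) ^ (i + 1) * w‖ := by
    intro i
    have hu0 : 0 < t ^ (i + 1) := by positivity
    have hut : t ^ (i + 1) ≤ t := by
      simpa using pow_le_pow_of_le_one ht0.le ht1.le (show 1 ≤ i + 1 by omega)
    have hui : t ^ (i + 1) ≤ t ^ i := pow_le_pow_of_le_one ht0.le ht1.le (by omega)
    have hre : 1 - t ^ (i + 1) ≤ ‖1 + (t : ℂ) ^ (i + 1) * w‖ := by
      refine le_trans ?_ (Complex.re_le_norm _)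
      rw [← Complex.ofReal_pow]
      simp only [Complex.add_re, Complex.one_re, Complex.re_ofReal_mul]
      nlinarith
    refine le_trans ?_ hre
    have hp : 0 < 1 - t ^ (i + 1) := by linarith
    have ha : 1 + t ^ i / (1 - t) ≤ Real.exp (t ^ i / (1 - t)) := by
      have := Real.add_one_le_exp (t ^ i / (1 - t)); linarith
    rw [Real.exp_neg]
    apply inv_le_of_inv_le₀ hp
    refine le_trans ?_ ha
    have hb : t ^ (i + 1) / (1 - t ^ (i + 1)) ≤ t ^ i / (1 - t) := by gcongr
    have hc : (1 - t ^ (i + 1))⁻¹ = 1 + t ^ (i + 1) / (1 - t ^ (i + 1)) := by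
      field_simp
      ring
    linarith
  have hs : ∑ i ∈ Finset.range n, t ^ i ≤ 1 / (1 - t) := by
    have := (summable_geometric_of_lt_one ht0.le ht1).sum_le_tsum (Finset.range n)
      (fun i _ => by positivity)
    rw [tsum_geometric_of_lt_one ht0.le ht1] at this
    simpa using this
  calc Real.exp (-(1 / (1 - t) / (1 - t)))
      ≤ Real.exp (∑ i ∈ Finset.range n, (-(t ^ i / (1 - t)))) := by
        rw [Real.exp_le_exp, Finset.sum_neg_distrib, ← Finset.sum_div]
        gcongr
    _ = ∏ i ∈ Finset.range n, Real.exp (-(t ^ i / (1 - t))) := Real.exp_sum _ _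
    _ ≤ ff t n w := Finset.prod_le_prod (fun _ _ => (Real.exp_pos _).le) fun i _ => key i

/-- Lower bound on a region. -/
def SS (t : ℝ) (m e : ℕ) : Prop :=
  ∃ c : ℝ, 0 < c ∧ c ≤ 1 ∧ ∀ n w y, 0 < y → y ≤ 1 → y ≤ |w.im| → -w.re * t ^ m ≤ 1 →
    c * y ^ e ≤ ff t n w

theorem SS_step1 (t : ℝ) (ht0 : 0 < t) (ht1 : t < 1) (m e : ℕ) (h : SS t m e) :
    SS t (m + 1) (e + 1) := by
  obtain ⟨c, hc0, hc1, hc⟩ := h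
  refine ⟨c * t ^ (e + 1), by positivity, ?_, ?_⟩
  · exact mul_le_one₀ hc1 (by positivity) (pow_le_one₀ ht0.le ht1.le)
  intro n w y hy0 hy1 hy hw
  rcases n with _ | n
  · rw [ff_zero]
    exact mul_le_one₀ (mul_le_one₀ hc1 (by positivity) (pow_le_one₀ ht0.le ht1.le))
      (by positivity) (pow_le_one₀ hy0.le hy1)
  · rw [ff_succ]
    have h2 := hc n (t * w) (t * y) (by positivity) (by nlinarith)
      (by rw [Complex.im_ofReal_mul, abs_mul, abs_of_pos ht0]; gcongr)
      (by rw [Complex.re_ofReal_mul]; rw [pow_succ] at hw; linarith)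
    have h3 : t * y ≤ ‖1 + (t : ℂ) * w‖ := by
      refine le_trans ?_ (Complex.abs_im_le_norm _)
      simp only [Complex.add_im, Complex.one_im, Complex.im_ofReal_mul, zero_add]
      rw [abs_mul, abs_of_pos ht0]; gcongr
    calc c * t ^ (e + 1) * y ^ (e + 1) = (t * y) * (c * (t * y) ^ e) := by ring
      _ ≤ _ := by gcongr

theorem norm_lower (t : ℝ) (w : ℂ) : -(t * w.re) - 1 ≤ ‖1 + (t : ℂ) * w‖ := by
  refine le_trans ?_ (Complex.abs_re_le_norm _)
  simp only [Complex.add_re, Complex.one_re, Complex.re_ofReal_mul]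
  refine le_trans ?_ (neg_le_abs _)
  linarith

theorem SS_step2 (t : ℝ) (ht0 : 0 < t) (ht1 : t < 1) (m : ℕ) (h : SS t (m + 2) 2) :
    SS t (m + 3) 2 := by
  obtain ⟨c, hc0, hc1, hc⟩ := h
  have hm : 0 < 1 / t ^ (m + 1) - 1 := by
    have : t ^ (m + 1) < 1 := pow_lt_one₀ ht0.le ht1 (by omega)
    have := (one_lt_div (by positivity : 0 < t ^ (m + 1))).2 this
    linarith
  set d := 1 / t ^ (m + 1) - 1 with hd
  refine ⟨min c (d * c * t ^ 2), by positivity, (min_le_left _ _).trans hc1, ?_⟩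
  intro n w y hy0 hy1 hy hw
  by_cases hx : -w.re * t ^ (m + 2) ≤ 1
  · refine le_trans ?_ (hc n w y hy0 hy1 hy hx)
    gcongr
    exact min_le_left _ _
  rcases n with _ | n
  · rw [ff_zero]
    exact mul_le_one₀ ((min_le_left _ _).trans hc1) (by positivity) (pow_le_one₀ hy0.le hy1)
  · rw [ff_succ]
    have h2 := hc n (t * w) (t * y) (by positivity) (by nlinarith)
      (by rw [Complex.im_ofReal_mul, abs_mul, abs_of_pos ht0]; gcongr)
      (by rw [Complex.re_ofReal_mul]
          have e : t ^ (m + 3) = t * t ^ (m + 2) := by ring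
          rw [e] at hw; linarith)
    have h3 : d ≤ ‖1 + (t : ℂ) * w‖ := by
      refine le_trans ?_ (norm_lower t w)
      rw [hd]
      have : 1 / t ^ (m + 1) ≤ -(t * w.re) := by
        rw [div_le_iff₀ (by positivity)]
        have e : t ^ (m + 2) = t * t ^ (m + 1) := by ring
        push Not at hx
        rw [e] at hx; linarith
      linarith
    calc min c (d * c * t ^ 2) * y ^ 2 ≤ (d * c * t ^ 2) * y ^ 2 := by
          gcongr; exact min_le_right _ _
      _ = d * (c * (t * y) ^ 2) := by ring
      _ ≤ _ := by gcongr

theorem SS_all (t : ℝ) (ht0 : 0 < t) (ht1 : t < 1) (m : ℕ) : SS t (m + 2) 2 := by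
  induction m with
  | zero =>
    apply SS_step1 t ht0 ht1
    apply SS_step1 t ht0 ht1
    obtain ⟨c, h0, h1, h⟩ := ff_base t ht0 ht1
    exact ⟨c, h0, h1, fun n w y _ _ _ hw => by simpa using h n w (by simpa using hw)⟩
  | succ m ih => exact SS_step2 t ht0 ht1 m ih

theorem ff_all (t : ℝ) (ht0 : 0 < t) (ht1 : t < 1) :
    ∃ c : ℝ, 0 < c ∧ ∀ n w y, 0 < y → y ≤ 1 → y ≤ |w.im| → c * y ^ 2 ≤ ff t n w := by
  obtain ⟨m, hm⟩ := exists_pow_lt_of_lt_one (show 0 < 1 / (1 / t ^ 2 + 1) by positivity) ht1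
  obtain ⟨c, hc0, hc1, hc⟩ := SS_all t ht0 ht1 m
  refine ⟨c, hc0, fun n => ?_⟩
  induction n with
  | zero =>
    intro w y hy0 hy1 hy
    rw [ff_zero]
    exact mul_le_one₀ hc1 (by positivity) (pow_le_one₀ hy0.le hy1)
  | succ n ih =>
    intro w y hy0 hy1 hy
    by_cases hx : -w.re * t ^ (m + 2) ≤ 1
    · exact hc _ w y hy0 hy1 hy hx
    push Not at hx
    rw [ff_succ]
    have h2 := ih (t * w) (t * y) (by positivity) (by nlinarith)
      (by rw [Complex.im_ofReal_mul, abs_mul, abs_of_pos ht0]; gcongr)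
    have h3 : 1 / t ^ 2 ≤ ‖1 + (t : ℂ) * w‖ := by
      refine le_trans ?_ (norm_lower t w)
      have hp : t ^ (m + 1) < 1 / (1 / t ^ 2 + 1) :=
        lt_of_le_of_lt (pow_le_pow_of_le_one ht0.le ht1.le (by omega)) hm
      rw [lt_div_iff₀ (by positivity)] at hp
      have e : t ^ (m + 2) = t * t ^ (m + 1) := by ring
      rw [e] at hx
      have hq : 0 < t ^ (m + 1) := by positivity
      have : t ^ (m + 1) * (1 / t ^ 2 + 1) < t ^ (m + 1) * (-(t * w.re)) := by linarith
      have := lt_of_mul_lt_mul_left this hq.le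
      linarith
    calc c * y ^ 2 = 1 / t ^ 2 * (c * (t * y) ^ 2) := by field_simp
      _ ≤ _ := by gcongr

theorem stmt8 (t : ℝ) (ht0 : 0 < t) (ht1 : t < 1) :
    ∃ C : ℝ, 0 < C ∧
      (∀ n : ℕ, 1 ≤ n → ∀ w ∈ tGSet,
        1 / C ≤ ‖∏ i ∈ Finset.range n, (1 + (t : ℂ) * w * (t : ℂ) ^ i)‖) ∧
      (∀ w ∈ tGSet,
        1 / C ≤ ‖∏' i : ℕ, (1 + (t : ℂ) * w * (t : ℂ) ^ i)‖) := by
  obtain ⟨a, ha0, -, ha⟩ := ff_base t ht0 ht1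
  obtain ⟨b, hb0, hb⟩ := ff_all t ht0 ht1
  have main : ∀ n : ℕ, ∀ w ∈ tGSet,
      min a b ≤ ‖∏ i ∈ Finset.range n, (1 + (t : ℂ) * w * (t : ℂ) ^ i)‖ := by
    intro n w hw
    have e : ‖∏ i ∈ Finset.range n, (1 + (t : ℂ) * w * (t : ℂ) ^ i)‖ = ff t n w := by
      rw [norm_prod, ff]
      refine Finset.prod_congr rfl fun i _ => ?_
      congr 2
      ring
    rw [e]
    rcases hw with ⟨h, -⟩ | ⟨h, -⟩ | ⟨-, h⟩
    · refine (min_le_right a b).trans ?_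
      simpa using hb n w 1 one_pos le_rfl (by simp [h])
    · refine (min_le_right a b).trans ?_
      simpa using hb n w 1 one_pos le_rfl (by simp [h])
    · exact (min_le_left a b).trans (ha n w (by linarith))
  refine ⟨1 / min a b, by positivity, ?_, ?_⟩
  · intro n _ w hw
    rw [one_div_one_div]
    exact main n w hw
  · intro w hw
    rw [one_div_one_div]
    have hsum : Summable fun i : ℕ => ‖(t : ℂ) * w * (t : ℂ) ^ i‖ := by
      simp_rw [norm_mul, norm_pow]
      apply Summable.mul_left
      apply summable_geometric_of_lt_one (norm_nonneg _)
      simpa [abs_of_pos ht0] using ht1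
    have hm := multipliable_one_add_of_summable hsum
    exact ge_of_tendsto' hm.hasProd.tendsto_prod_nat.norm fun n => main n w hw
end

section
/- For every real t with 0 < t < 1 and every integer m ≥ 0 there exists a constant C > 0 such that for every point z of the set tG, the series Σ_{L∈ℤ} t^{−(m+1)L} / |(−t^{−L} z;t)_∞| converges and its sum is at most C. -/
open scoped BigOperators

/-- Lower bound for the factor at relative position `j`. -/
noncomputable def facLB (q : ℝ) (j : ℤ) : ℝ :=
  if j = 0 then 1 else if 0 < j then 1 - q ^ (2 * j - 1) else q ^ (2 * j + 1) - 1

/-- The shifted product of the lower bounds. -/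
noncomputable def prodLB (q : ℝ) (K : ℤ) : ℝ := ∏' i : ℕ, facLB q ((i : ℤ) - K)

/-- The dominating sequence. -/
noncomputable def domSeq (q : ℝ) (m : ℕ) (K : ℤ) : ℝ :=
  (q ^ 2) ^ (-((m : ℤ) + 1) * K) / prodLB q K

lemma facLB_pos {q : ℝ} (h0 : 0 < q) (h1 : q < 1) (j : ℤ) : 0 < facLB q j := by
  unfold facLB
  split_ifs with h h'
  · norm_num
  · have := zpow_lt_one₀ h0 h1 (n := 2 * j - 1) (by omega)
    linarith
  · have := one_lt_zpow_of_neg₀ h0 h1 (n := 2 * j + 1) (by omega)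
    linarith

lemma facLB_summable {q : ℝ} (h0 : 0 < q) (h1 : q < 1) (K : ℤ) :
    Summable fun i : ℕ => ‖facLB q ((i : ℤ) - K) - 1‖ := by
  have hs : Summable fun i : ℕ => q ^ (-2 * K - 1) * (q ^ 2) ^ i :=
    (summable_geometric_of_lt_one (by positivity) (by nlinarith)).mul_left _
  refine hs.of_norm_bounded_eventually_nat ?_
  filter_upwards [Filter.eventually_gt_atTop K.toNat] with i hi
  have hj : 0 < (i : ℤ) - K := by omega
  have : facLB q ((i : ℤ) - K) - 1 = - (q ^ (-2 * K - 1) * (q ^ 2) ^ i) := by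
    unfold facLB
    rw [if_neg hj.ne', if_pos hj, ← pow_mul, ← zpow_natCast q (2 * i), ← zpow_add₀ h0.ne']
    have : 2 * ((i : ℤ) - K) - 1 = -2 * K - 1 + ((2 * i : ℕ) : ℤ) := by push_cast; ring
    rw [this]; ring
  rw [this, norm_norm, norm_neg, Real.norm_of_nonneg (by positivity)]

lemma facLB_multipliable {q : ℝ} (h0 : 0 < q) (h1 : q < 1) (K : ℤ) :
    Multipliable fun i : ℕ => facLB q ((i : ℤ) - K) := by
  have := multipliable_one_add_of_summable (facLB_summable h0 h1 K)
  simpa using this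

lemma prodLB_pos {q : ℝ} (h0 : 0 < q) (h1 : q < 1) (K : ℤ) : 0 < prodLB q K := by
  have hne : prodLB q K ≠ 0 := by
    have := tprod_one_add_ne_zero_of_summable (f := fun i : ℕ => facLB q ((i : ℤ) - K) - 1)
      (fun i => by simpa using (facLB_pos h0 h1 _).ne') (facLB_summable h0 h1 K)
    simpa [prodLB] using this
  have hnn : 0 ≤ prodLB q K :=
    ge_of_tendsto' (facLB_multipliable h0 h1 K).tendsto_prod_tprod_nat
      (fun n => Finset.prod_nonneg fun i _ => (facLB_pos h0 h1 _).le)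
  exact lt_of_le_of_ne hnn hne.symm

lemma prodLB_succ {q : ℝ} (h0 : 0 < q) (h1 : q < 1) (K : ℤ) :
    prodLB q (K + 1) = facLB q (-K - 1) * prodLB q K := by
  have hE : (fun n : ℕ => facLB q (((n + 1 : ℕ) : ℤ) - (K + 1)))
      = fun n : ℕ => facLB q ((n : ℤ) - K) := by
    funext n; congr 1; push_cast; ring
  unfold prodLB
  rw [tprod_eq_zero_mul' (by rw [hE]; exact facLB_multipliable h0 h1 K), hE]
  congr 2; push_cast; ring

lemma domSeq_pos {q : ℝ} (h0 : 0 < q) (h1 : q < 1) (m : ℕ) (K : ℤ) : 0 < domSeq q m K :=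
  div_pos (by positivity) (prodLB_pos h0 h1 K)

lemma domSeq_succ {q : ℝ} (h0 : 0 < q) (h1 : q < 1) (m : ℕ) (K : ℤ) :
    domSeq q m (K + 1) * facLB q (-K - 1) = ((q ^ 2) ^ (m + 1))⁻¹ * domSeq q m K := by
  have hp := prodLB_pos h0 h1 K
  have hf := facLB_pos h0 h1 (-K - 1)
  have e : (q ^ 2) ^ (-((m : ℤ) + 1) * (K + 1))
      = ((q ^ 2) ^ (m + 1))⁻¹ * (q ^ 2) ^ (-((m : ℤ) + 1) * K) := by
    rw [mul_add, mul_one, zpow_add₀ (by positivity), zpow_neg, mul_comm]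
    norm_cast
  unfold domSeq
  rw [prodLB_succ h0 h1, e]
  field_simp

lemma domSeq_summable {q : ℝ} (h0 : 0 < q) (h1 : q < 1) (m : ℕ) : Summable (domSeq q m) := by
  have hq2 : q ^ 2 < 1 := by nlinarith
  apply Summable.of_nat_of_neg
  · refine summable_of_ratio_test_tendsto_lt_one (l := 0) (by norm_num)
      (Filter.Eventually.of_forall fun n => (domSeq_pos h0 h1 m _).ne') ?_
    have hr : ∀ n : ℕ, ‖domSeq q m ((n + 1 : ℕ) : ℤ)‖ / ‖domSeq q m (n : ℤ)‖
        = ((q ^ 2) ^ (m + 1))⁻¹ * ((q⁻¹ ^ (2 * n + 1)) - 1)⁻¹ := by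
      intro n
      have h := domSeq_succ h0 h1 m n
      have hp := domSeq_pos h0 h1 m n
      have hf := facLB_pos h0 h1 (-(n : ℤ) - 1)
      have hv : facLB q (-(n : ℤ) - 1) = q⁻¹ ^ (2 * n + 1) - 1 := by
        unfold facLB
        rw [if_neg (by omega), if_neg (by omega), inv_pow, ← zpow_natCast, ← zpow_neg]
        congr 2; push_cast; ring
      rw [← hv, Real.norm_of_nonneg (domSeq_pos h0 h1 m _).le, Real.norm_of_nonneg hp.le,
        div_eq_iff hp.ne', mul_right_comm, ← h]
      push_cast
      field_simp
    simp_rw [hr]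
    rw [← mul_zero (((q ^ 2) ^ (m + 1))⁻¹)]
    refine Filter.Tendsto.const_mul _ (Filter.Tendsto.inv_tendsto_atTop ?_)
    refine Filter.tendsto_atTop_add_const_right _ _ ?_
    refine (tendsto_pow_atTop_atTop_of_one_lt ((one_lt_inv₀ h0).2 h1)).comp ?_
    refine Filter.tendsto_atTop_mono (fun n => ?_) Filter.tendsto_id
    simp only [id]; omega
  · refine summable_of_ratio_test_tendsto_lt_one (l := 1 * (q ^ 2) ^ (m + 1))
      (by rw [one_mul]; exact pow_lt_one₀ (by positivity) hq2 (by omega))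
      (Filter.Eventually.of_forall fun n => (domSeq_pos h0 h1 m _).ne') ?_
    have hr : ∀ n : ℕ, ‖domSeq q m (-((n + 1 : ℕ) : ℤ))‖ / ‖domSeq q m (-(n : ℤ))‖
        = facLB q n * (q ^ 2) ^ (m + 1) := by
      intro n
      have h := domSeq_succ h0 h1 m (-((n + 1 : ℕ) : ℤ))
      have hp := domSeq_pos h0 h1 m (-(n : ℤ))
      rw [show -((n + 1 : ℕ) : ℤ) + 1 = -(n : ℤ) by push_cast; ring,
        show - -((n + 1 : ℕ) : ℤ) - 1 = (n : ℤ) by push_cast; ring] at h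
      rw [Real.norm_of_nonneg (domSeq_pos h0 h1 m _).le, Real.norm_of_nonneg hp.le,
        div_eq_iff hp.ne', mul_right_comm, mul_comm (facLB q n), h]
      field_simp
    simp_rw [hr]
    refine Filter.Tendsto.mul_const _ ?_
    have h := (facLB_summable h0 h1 0).tendsto_atTop_zero
    have h2 := (tendsto_zero_iff_norm_tendsto_zero.2 h).add_const 1
    simpa using h2

lemma tG_norm {z : ℂ} (hz : z ∈ tGSet) : 1 ≤ ‖z‖ := by
  rcases hz with ⟨h, _⟩ | ⟨h, _⟩ | ⟨h, _⟩
  · have := Complex.abs_im_le_norm z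
    rw [h] at this; simpa using this
  · have := Complex.abs_im_le_norm z
    rw [h] at this; simpa using this
  · exact h.ge

lemma tG_fac {z : ℂ} (hz : z ∈ tGSet) {s : ℝ} (hs : 0 < s) : ‖z‖⁻¹ ≤ ‖1 + (s : ℂ) * z‖ := by
  have hr := tG_norm hz
  have key : |z.im| ≤ ‖1 + (s : ℂ) * z‖ * ‖z‖ := by
    have := Complex.abs_im_le_norm ((1 + (s : ℂ) * z) * (starRingEnd ℂ) z)
    rw [norm_mul, Complex.norm_conj] at this
    convert this using 1
    rw [← abs_neg]
    congr 1
    simp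
    ring
  have hz0 : 0 < ‖z‖ := by linarith
  rcases hz with ⟨h, _⟩ | ⟨h, _⟩ | ⟨h, h'⟩
  · rw [inv_le_iff_one_le_mul₀ hz0]; rw [h] at key; simpa using key
  · rw [inv_le_iff_one_le_mul₀ hz0]; rw [h] at key; simpa using key
  · rw [h, inv_one]
    have := Complex.abs_re_le_norm (1 + (s : ℂ) * z)
    have h3 := le_abs_self (1 + (s : ℂ) * z).re
    simp at this h3
    have : 0 < s * z.re := by positivity
    linarith

lemma fac_ge {q : ℝ} (h0 : 0 < q) {s : ℝ} (hs : 0 < s) {z : ℂ} {ρ : ℝ}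
    (hρ1 : q ≤ ρ) (hρ2 : ρ ≤ q⁻¹) {j : ℤ} (hj : j ≠ 0) (h : s * ‖z‖ = q ^ (2 * j) * ρ) :
    facLB q j ≤ ‖1 + (s : ℂ) * z‖ := by
  have hn : ‖(s : ℂ) * z‖ = q ^ (2 * j) * ρ := by
    rw [norm_mul, Complex.norm_real, Real.norm_of_nonneg hs.le, h]
  have a1 : 1 - ‖(s : ℂ) * z‖ ≤ ‖1 + (s : ℂ) * z‖ := by
    have := norm_sub_norm_le (1 : ℂ) (-((s : ℂ) * z))
    simpa using this
  have a2 : ‖(s : ℂ) * z‖ - 1 ≤ ‖1 + (s : ℂ) * z‖ := by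
    have := norm_sub_norm_le ((s : ℂ) * z) (-1)
    simpa [add_comm] using this
  rw [hn] at a1 a2
  have hp : 0 < q ^ (2 * j) := by positivity
  unfold facLB
  rw [if_neg hj]
  split_ifs
  · have := mul_le_mul_of_nonneg_left hρ2 hp.le
    rw [zpow_sub_one₀ h0.ne']; linarith
  · have := mul_le_mul_of_nonneg_left hρ1 hp.le
    rw [zpow_add_one₀ h0.ne']; linarith

lemma prod_ge {q : ℝ} (h0 : 0 < q) (h1 : q < 1) {z : ℂ} (hz : z ∈ tGSet) {ρ : ℝ} {N : ℤ}
    (hρ1 : q ≤ ρ) (hρ2 : ρ ≤ q⁻¹) (hN : (q ^ 2) ^ N * ‖z‖ = ρ) (L : ℤ) :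
    ‖z‖⁻¹ * prodLB q (L + N) ≤
      ‖∏' i : ℕ, (1 + ((((q ^ 2) ^ (-L) : ℝ)) : ℂ) * z * ((q ^ 2 : ℝ) : ℂ) ^ i)‖ := by
  have hr := tG_norm hz
  have hinv : ‖z‖⁻¹ ≤ 1 := inv_le_one_of_one_le₀ hr
  have hinv0 : 0 ≤ ‖z‖⁻¹ := by positivity
  set w : ℂ := ((((q ^ 2) ^ (-L) : ℝ)) : ℂ) * z with hw
  have hq2 : q ^ 2 < 1 := by nlinarith
  have hm : Multipliable fun i : ℕ => (1 + w * ((q ^ 2 : ℝ) : ℂ) ^ i) := by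
    apply multipliable_one_add_of_summable
    have : Summable fun i : ℕ => ‖w‖ * (q ^ 2) ^ i :=
      (summable_geometric_of_lt_one (by positivity) hq2).mul_left _
    refine this.congr fun i => ?_
    rw [norm_mul w, norm_pow, Complex.norm_real, Real.norm_of_nonneg (by positivity : 0 ≤ q ^ 2)]
  refine le_of_tendsto_of_tendsto'
    ((facLB_multipliable h0 h1 (L + N)).tendsto_prod_tprod_nat.const_mul (‖z‖⁻¹))
    (hm.tendsto_prod_tprod_nat.norm) fun n => ?_
  rw [norm_prod]
  have hδ : ‖z‖⁻¹ ≤ ∏ i ∈ Finset.range n, (if (i : ℤ) - (L + N) = 0 then ‖z‖⁻¹ else 1) := by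
    by_cases hex : ∃ k ∈ Finset.range n, (k : ℤ) - (L + N) = 0
    · obtain ⟨k, hk, hk0⟩ := hex
      rw [Finset.prod_eq_single_of_mem k hk]
      · rw [if_pos hk0]
      · intro b _ hb
        rw [if_neg]
        omega
    · push Not at hex
      rw [Finset.prod_eq_one]
      · exact hinv
      · intro i hi
        rw [if_neg (hex i hi)]
  calc _ ≤ (∏ i ∈ Finset.range n, (if (i : ℤ) - (L + N) = 0 then ‖z‖⁻¹ else 1)) *
        ∏ i ∈ Finset.range n, facLB q ((i : ℤ) - (L + N)) :=
        mul_le_mul_of_nonneg_right hδ (Finset.prod_nonneg fun i _ => (facLB_pos h0 h1 _).le)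
    _ = ∏ i ∈ Finset.range n, ((if (i : ℤ) - (L + N) = 0 then ‖z‖⁻¹ else 1) *
        facLB q ((i : ℤ) - (L + N))) := Finset.prod_mul_distrib.symm
    _ ≤ _ := by
      refine Finset.prod_le_prod (fun i _ => ?_) (fun i _ => ?_)
      · exact mul_nonneg (by split_ifs <;> positivity) (facLB_pos h0 h1 _).le
      · have hs : 0 < (q ^ 2) ^ ((i : ℤ) - L) := by positivity
        have e : w * ((q ^ 2 : ℝ) : ℂ) ^ i = (((q ^ 2) ^ ((i : ℤ) - L) : ℝ) : ℂ) * z := by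
          rw [hw, sub_eq_neg_add, zpow_add₀ (by positivity), zpow_natCast]
          push_cast; ring
        rw [e]
        split_ifs with hi
        · rw [hi]
          have := tG_fac hz hs
          simpa [facLB] using this
        · rw [one_mul]
          refine fac_ge h0 hs hρ1 hρ2 hi ?_
          rw [← hN, ← mul_assoc]
          congr 1
          rw [zpow_mul, zpow_ofNat, ← zpow_add₀ (by positivity)]
          congr 1; ring

lemma exists_shift {q : ℝ} (h0 : 0 < q) (h1 : q < 1) {r : ℝ} (hr : 1 ≤ r) :
    ∃ N : ℤ, q ≤ (q ^ 2) ^ N * r ∧ (q ^ 2) ^ N * r ≤ q⁻¹ := by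
  have hq2 : q ^ 2 < 1 := by nlinarith
  obtain ⟨N, hN1, hN2⟩ := exists_mem_Ico_zpow (x := r / q) (y := (q ^ 2)⁻¹)
    (by positivity) ((one_lt_inv₀ (by positivity)).2 hq2)
  refine ⟨N, ?_, ?_⟩
  · rw [inv_zpow, inv_le_iff_one_le_mul₀ (by positivity)] at hN1
    rw [div_mul_eq_mul_div, le_div_iff₀ h0] at hN1
    linarith
  · rw [zpow_add_one₀ (by positivity), inv_zpow, ← mul_inv, lt_inv_comm₀ (by positivity)
      (by positivity)] at hN2
    have : (q ^ 2) ^ N * q ^ 2 < q / r := by rwa [inv_div] at hN2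
    rw [lt_div_iff₀ (by positivity)] at this
    rw [← one_div, le_div_iff₀ h0]
    nlinarith

theorem stmt9 (t : ℝ) (ht0 : 0 < t) (ht1 : t < 1) (m : ℕ) :
    ∃ C : ℝ, 0 < C ∧ ∀ z ∈ tGSet,
      (Summable fun L : ℤ =>
        t ^ (-((m : ℤ) + 1) * L) /
          ‖∏' i : ℕ, (1 + ((t ^ (-L) : ℝ) : ℂ) * z * (t : ℂ) ^ i)‖) ∧
      (∑' L : ℤ,
        t ^ (-((m : ℤ) + 1) * L) /
          ‖∏' i : ℕ, (1 + ((t ^ (-L) : ℝ) : ℂ) * z * (t : ℂ) ^ i)‖) ≤ C := by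
  obtain ⟨q, h0, h1, rfl⟩ : ∃ q : ℝ, 0 < q ∧ q < 1 ∧ t = q ^ 2 :=
    ⟨√t, Real.sqrt_pos.2 ht0, by rw [Real.sqrt_lt' one_pos]; simpa using ht1,
      (Real.sq_sqrt ht0.le).symm⟩
  have hS := domSeq_summable h0 h1 m
  have hS0 : 0 ≤ ∑' K, domSeq q m K := tsum_nonneg fun K => (domSeq_pos h0 h1 m K).le
  refine ⟨q⁻¹ ^ (m + 1) * (∑' K, domSeq q m K) + 1, by positivity, fun z hz => ?_⟩
  have hr := tG_norm hz
  have hr0 : 0 < ‖z‖ := by linarith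
  obtain ⟨N, hN1, hN2⟩ := exists_shift h0 h1 hr
  have hT0 : 0 < (q ^ 2) ^ N := by positivity
  have hB : ((q ^ 2) ^ N) ^ (m + 1) * ‖z‖ ≤ q⁻¹ ^ (m + 1) := by
    rw [pow_succ, pow_succ, mul_assoc]
    refine mul_le_mul (pow_le_pow_left₀ hT0.le ?_ _) hN2 (by positivity) (pow_nonneg (inv_pos.2 h0).le _)
    nlinarith
  have hle : ∀ L : ℤ, (q ^ 2) ^ (-((m : ℤ) + 1) * L) /
      ‖∏' i : ℕ, (1 + ((((q ^ 2) ^ (-L) : ℝ)) : ℂ) * z * ((q ^ 2 : ℝ) : ℂ) ^ i)‖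
      ≤ q⁻¹ ^ (m + 1) * domSeq q m (L + N) := by
    intro L
    have hp := prodLB_pos h0 h1 (L + N)
    have h := prod_ge h0 h1 hz hN1 hN2 rfl L
    have e : (q ^ 2) ^ (-((m : ℤ) + 1) * L)
        = ((q ^ 2) ^ N) ^ (m + 1) * (q ^ 2) ^ (-((m : ℤ) + 1) * (L + N)) := by
      rw [← zpow_natCast ((q ^ 2) ^ N), ← zpow_mul, ← zpow_add₀ (by positivity)]
      congr 1; push_cast; ring
    calc _ ≤ (q ^ 2) ^ (-((m : ℤ) + 1) * L) / (‖z‖⁻¹ * prodLB q (L + N)) :=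
          div_le_div_of_nonneg_left (by positivity) (by positivity) h
      _ = (((q ^ 2) ^ N) ^ (m + 1) * ‖z‖) * domSeq q m (L + N) := by
          rw [e]; unfold domSeq; field_simp
      _ ≤ _ := mul_le_mul_of_nonneg_right hB (domSeq_pos h0 h1 m _).le
  have hS' : Summable fun L : ℤ => q⁻¹ ^ (m + 1) * domSeq q m (L + N) :=
    ((Equiv.addRight N).summable_iff.2 hS).mul_left _
  have hsum := Summable.of_nonneg_of_le (fun L => by positivity) hle hS'
  refine ⟨hsum, ?_⟩
  have h2 := hsum.tsum_le_tsum hle hS'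
  rw [tsum_mul_left, show (∑' L : ℤ, domSeq q m (L + N)) = ∑' K, domSeq q m K from
    (Equiv.addRight N).tsum_eq (domSeq q m)] at h2
  linarith
end

section
/- Let t be real with 0 < t < 1, let L be an integer, and let z = x ± √(1−x²) i with 0 ≤ x ≤ 1 (i.e., z is on the unit circle with Re(z) ≥ 0). Then |(−t^{−L} z;t)_∞| ≥ √((−t^{−2L};t²)_∞). -/
open scoped BigOperators

theorem stmt10 (t : ℝ) (ht0 : 0 < t) (ht1 : t < 1) (L : ℤ) (x : ℝ)
    (hx0 : 0 ≤ x) (hx1 : x ≤ 1) (ε : ℝ) (hε : ε = 1 ∨ ε = -1) :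
    Real.sqrt (∏' i : ℕ, (1 + t ^ (2 * (i : ℤ) - 2 * L))) ≤
      norm (∏' i : ℕ,
        (1 + ((t ^ (-L) : ℝ) : ℂ) *
          ((x : ℂ) + (ε : ℂ) * ((Real.sqrt (1 - x ^ 2) : ℝ) : ℂ) * Complex.I) *
          (t : ℂ) ^ i)) := by
  have hc : 0 < t ^ (-L) := zpow_pos ht0 _
  have he : ∀ i : ℕ, t ^ (2 * (i : ℤ) - 2 * L) = (t ^ (-L)) ^ 2 * (t ^ 2) ^ i := by
    intro i
    rw [← pow_mul, ← zpow_natCast (t ^ (-L)) 2, ← zpow_natCast t (2 * i), ← zpow_mul,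
      ← zpow_add₀ ht0.ne']
    congr 1
    push_cast
    ring
  simp_rw [he]
  generalize t ^ (-L) = c at *
  have hm1 : Multipliable (fun i : ℕ => 1 + c ^ 2 * (t ^ 2) ^ i) := by
    apply multipliable_one_add_of_summable
    have h : Summable (fun i : ℕ => c ^ 2 * (t ^ 2) ^ i) :=
      (summable_geometric_of_lt_one (by positivity) (by nlinarith)).mul_left _
    exact h.norm
  have hm2 : Multipliable (fun i : ℕ => 1 + (c : ℂ) *
          ((x : ℂ) + (ε : ℂ) * ((Real.sqrt (1 - x ^ 2) : ℝ) : ℂ) * Complex.I) *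
          (t : ℂ) ^ i) := by
    apply multipliable_one_add_of_summable
    simp_rw [norm_mul _ ((t : ℂ) ^ _), norm_pow]
    apply Summable.mul_left
    apply summable_geometric_of_lt_one (norm_nonneg _)
    simpa [abs_of_pos ht0] using ht1
  have hs : Real.sqrt (1 - x ^ 2) ^ 2 = 1 - x ^ 2 := Real.sq_sqrt (by nlinarith)
  have hε2 : ε ^ 2 = 1 := by rcases hε with h | h <;> simp [h]
  apply Real.sqrt_le_iff.mpr ⟨norm_nonneg _, ?_⟩
  refine le_of_tendsto_of_tendsto' hm1.hasProd.tendsto_prod_nat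
    ((hm2.hasProd.tendsto_prod_nat.norm).pow 2) ?_
  intro n
  rw [norm_prod, ← Finset.prod_pow]
  apply Finset.prod_le_prod
  · intro i _
    positivity
  · intro i _
    have h : (1 + (c : ℂ) *
          ((x : ℂ) + (ε : ℂ) * ((Real.sqrt (1 - x ^ 2) : ℝ) : ℂ) * Complex.I) *
          (t : ℂ) ^ i) = ((1 + c * t ^ i * x : ℝ) : ℂ) +
            ((c * t ^ i * (ε * Real.sqrt (1 - x ^ 2)) : ℝ) : ℂ) * Complex.I := by
      push_cast
      ring
    rw [h, Complex.sq_norm, Complex.normSq_add_mul_I, mul_pow _ (ε * _), mul_pow ε, hs, hε2,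
      pow_right_comm]
    have : 0 ≤ c * t ^ i * x := by positivity
    nlinarith
end

section
/- Let t be real with 0 < t < 1, let n ∈ ℤ, let L ∈ ℤ with L < −n, let u ∈ [−1/2, 1/2], and let z = −t^{−n+u} + εi with ε ∈ {−1, 1}. Then |(−t^{−L} z;t)_∞| ≥ (t^{1/2};t)_∞. -/
open scoped BigOperators

theorem stmt11 (t : ℝ) (ht0 : 0 < t) (ht1 : t < 1) (n L : ℤ) (hL : L < -n)
    (u : ℝ) (hu1 : -(1/2) ≤ u) (hu2 : u ≤ 1/2) (ε : ℝ) (hε : ε = 1 ∨ ε = -1) :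
    sqrtPochInf t ≤
      norm (∏' i : ℕ,
        (1 + ((t ^ (-L) : ℝ) : ℂ) *
          (((-(t ^ ((-n : ℝ) + u)) : ℝ) : ℂ) + (ε : ℂ) * Complex.I) *
          (t : ℂ) ^ i)) := by
  have hgeo : Summable (fun i : ℕ => t ^ i) := summable_geometric_of_lt_one ht0.le ht1
  have key : t ^ (-L) * t ^ ((-n : ℝ) + u) ≤ Real.sqrt t := by
    rw [← Real.rpow_intCast, ← Real.rpow_add ht0, Real.sqrt_eq_rpow]
    apply Real.rpow_le_rpow_of_exponent_ge ht0 ht1.le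
    have h : L + 1 ≤ -n := hL
    have h' : (L : ℝ) + 1 ≤ -(n : ℝ) := by exact_mod_cast h
    push_cast
    linarith
  have hs1 : Real.sqrt t ≤ 1 := Real.sqrt_le_one.mpr ht1.le
  have m1 : Multipliable (fun i : ℕ => 1 - Real.sqrt t * t ^ i) := by
    have : Multipliable (fun i : ℕ => 1 + (-(Real.sqrt t * t ^ i))) := by
      apply multipliable_one_add_of_summable
      simpa [abs_mul, abs_of_pos ht0] using hgeo.mul_left |Real.sqrt t|
    simpa [sub_eq_add_neg] using this
  have m2 : Multipliable (fun i : ℕ => (1 + ((t ^ (-L) : ℝ) : ℂ) *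
          (((-(t ^ ((-n : ℝ) + u)) : ℝ) : ℂ) + (ε : ℂ) * Complex.I) *
          (t : ℂ) ^ i)) := by
    apply multipliable_one_add_of_summable
    simp only [norm_mul _ ((t : ℂ) ^ _), norm_pow, Complex.norm_real, Real.norm_eq_abs,
      abs_of_pos ht0]
    exact hgeo.mul_left _
  unfold sqrtPochInf
  refine le_of_tendsto_of_tendsto' m1.hasProd.tendsto_prod_nat
    m2.hasProd.tendsto_prod_nat.norm (fun N => ?_)
  rw [norm_prod]
  apply Finset.prod_le_prod
  · intro i _
    have := pow_le_one₀ ht0.le ht1.le (n := i)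
    have := mul_le_one₀ hs1 (pow_nonneg ht0.le i) this
    linarith
  · intro i _
    refine le_trans ?_ (Complex.re_le_norm _)
    have hre : (1 + ((t ^ (-L) : ℝ) : ℂ) *
          (((-(t ^ ((-n : ℝ) + u)) : ℝ) : ℂ) + (ε : ℂ) * Complex.I) *
          (t : ℂ) ^ i).re = 1 - (t ^ (-L) * t ^ ((-n : ℝ) + u)) * t ^ i := by
      rw [← Complex.ofReal_pow]
      simp only [Complex.add_re, Complex.one_re, Complex.re_mul_ofReal, Complex.re_ofReal_mul,
        Complex.ofReal_re, Complex.I_re]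
      ring
    rw [hre]
    have := mul_le_mul_of_nonneg_right key (pow_nonneg ht0.le i)
    linarith
end

section
/- Let t be real with 0 < t < 1, let n ∈ ℤ with n < 0, let L ∈ ℤ with L ≥ 0, let u ∈ [−1/2, 1/2], and let z = −t^{−n+u} + εi with ε ∈ {−1, 1}. Then |(−t^{−L} z;t)_∞| ≥ t^{−L(L+1)/2} (t^{1/2};t)_∞. -/
open scoped BigOperators

theorem aux_first (t : ℝ) (ht0 : 0 < t) (K : ℕ) (f : ℕ → ℂ)
    (hf : ∀ i ≤ K, (t⁻¹) ^ (K - i) ≤ ‖f i‖) :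
    t ^ (-((K : ℤ) * ((K : ℤ) + 1) / 2)) ≤ ‖∏ i ∈ Finset.range (K + 1), f i‖ := by
  have h1 : t ^ (-((K : ℤ) * ((K : ℤ) + 1) / 2)) = ∏ i ∈ Finset.range (K + 1), (t⁻¹) ^ (K - i) := by
    have h2 := Finset.prod_range_reflect (fun j => (t⁻¹) ^ j) (K + 1)
    simp only [Nat.add_sub_cancel] at h2
    rw [h2, Finset.prod_pow_eq_pow_sum, Finset.sum_range_id]
    simp only [Nat.add_sub_cancel]
    rw [zpow_neg, inv_pow, ← zpow_natCast]
    congr 2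
    push_cast
    rw [mul_comm]
  rw [h1, norm_prod]
  apply Finset.prod_le_prod
  · intro i _
    positivity
  · intro i hi
    exact hf i (by simpa [Nat.lt_succ_iff] using hi)

theorem stmt12 (t : ℝ) (ht0 : 0 < t) (ht1 : t < 1) (n L : ℤ) (hn : n < 0) (hL : 0 ≤ L)
    (u : ℝ) (hu1 : -(1/2) ≤ u) (hu2 : u ≤ 1/2) (ε : ℝ) (hε : ε = 1 ∨ ε = -1) :
    t ^ (-(L * (L + 1) / 2)) * sqrtPochInf t ≤
      norm (E := ℂ) (∏' i : ℕ,
        (1 + ((t ^ (-L) : ℝ) : ℂ) *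
          (((-(t ^ ((-n : ℝ) + u)) : ℝ) : ℂ) + (ε : ℂ) * Complex.I) *
          (t : ℂ) ^ i)) := by
  obtain ⟨K, rfl⟩ := Int.eq_ofNat_of_zero_le hL
  set x : ℝ := t ^ ((-n : ℝ) + u) with hx
  have hx0 : 0 < x := Real.rpow_pos_of_pos ht0 _
  have hxs : x ≤ Real.sqrt t := by
    rw [Real.sqrt_eq_rpow, hx]
    apply Real.rpow_le_rpow_of_exponent_ge ht0 ht1.le
    have : (n : ℝ) ≤ -1 := by exact_mod_cast (by omega : n ≤ -1)
    linarith
  have hs1 : Real.sqrt t ≤ 1 := Real.sqrt_le_one.mpr ht1.le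
  have hs0 : 0 ≤ Real.sqrt t := Real.sqrt_nonneg t
  have hp1 : ∀ i : ℕ, t ^ i ≤ 1 := fun i => pow_le_one₀ ht0.le ht1.le
  have hp0 : ∀ i : ℕ, 0 < t ^ i := fun i => pow_pos ht0 i
  set f : ℕ → ℂ := fun i => 1 + ((t ^ (-(K : ℤ)) : ℝ) : ℂ) *
          (((-x : ℝ) : ℂ) + (ε : ℂ) * Complex.I) * (t : ℂ) ^ i with hf
  have hre : ∀ i, (f i).re = 1 - t ^ (-(K : ℤ)) * t ^ i * x := by
    intro i
    have : f i = ((1 - t ^ (-(K : ℤ)) * t ^ i * x : ℝ) : ℂ)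
      + ((t ^ (-(K : ℤ)) * t ^ i * ε : ℝ) : ℂ) * Complex.I := by
      simp only [hf]; push_cast; ring
    rw [this]; simp only [Complex.add_re, Complex.ofReal_re, Complex.re_ofReal_mul, Complex.I_re]; ring
  have him : ∀ i, (f i).im = t ^ (-(K : ℤ)) * t ^ i * ε := by
    intro i
    have : f i = ((1 - t ^ (-(K : ℤ)) * t ^ i * x : ℝ) : ℂ)
      + ((t ^ (-(K : ℤ)) * t ^ i * ε : ℝ) : ℂ) * Complex.I := by
      simp only [hf]; push_cast; ring
    rw [this]; simp only [Complex.add_im, Complex.ofReal_im, Complex.im_ofReal_mul, Complex.I_im]; ring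
  have hε1 : |ε| = 1 := by rcases hε with h | h <;> simp [h]
  have hfirst : ∀ i ≤ K, (t⁻¹) ^ (K - i) ≤ ‖f i‖ := by
    intro i hi
    refine le_trans ?_ (Complex.abs_im_le_norm _)
    rw [him, abs_mul, hε1, mul_one, abs_of_pos (by positivity), inv_pow, zpow_neg, zpow_natCast]
    apply le_of_eq
    obtain ⟨d, rfl⟩ := Nat.exists_eq_add_of_le hi
    rw [Nat.add_sub_cancel_left, pow_add]
    have := (hp0 i).ne'
    have := (hp0 d).ne'
    field_simp
  have hsecond : ∀ i, 1 - Real.sqrt t * t ^ i ≤ ‖f (K + 1 + i)‖ := by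
    intro i
    refine le_trans ?_ ((le_abs_self _).trans (Complex.abs_re_le_norm _))
    rw [hre]
    have h1 : t ^ (-(K : ℤ)) * t ^ (K + 1 + i) = t * t ^ i := by
      rw [zpow_neg, zpow_natCast, pow_add, pow_add]
      have := (hp0 K).ne'
      field_simp
    rw [h1]
    have h2 : t * t ^ i * x ≤ t ^ i * Real.sqrt t := by
      apply mul_le_mul _ hxs hx0.le (hp0 i).le
      nlinarith [hp0 i]
    linarith
  have hgeo : Summable (fun i : ℕ => t ^ i) := summable_geometric_of_lt_one ht0.le ht1
  have hmf : Multipliable f := by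
    apply multipliable_one_add_of_summable
    have : (fun i : ℕ => ‖((t ^ (-(K : ℤ)) : ℝ) : ℂ) *
          (((-x : ℝ) : ℂ) + (ε : ℂ) * Complex.I) * (t : ℂ) ^ i‖) = fun i : ℕ =>
          ‖((t ^ (-(K : ℤ)) : ℝ) : ℂ) * (((-x : ℝ) : ℂ) + (ε : ℂ) * Complex.I)‖ * t ^ i := by
      funext i
      rw [norm_mul, norm_pow, Complex.norm_real, Real.norm_of_nonneg ht0.le]
    rw [this]
    exact hgeo.mul_left _
  have hmg : Multipliable (fun i : ℕ => 1 - Real.sqrt t * t ^ i) := by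
    have : (fun i : ℕ => 1 - Real.sqrt t * t ^ i) = fun i => 1 + (-(Real.sqrt t * t ^ i)) := by
      funext i; ring
    rw [this]
    apply multipliable_one_add_of_summable
    simp only [norm_neg]
    exact (hgeo.mul_left _).norm
  have hlf := ((Filter.tendsto_add_atTop_iff_nat (K + 1)).mpr hmf.hasProd.tendsto_prod_nat).norm
  have hlg := hmg.hasProd.tendsto_prod_nat.const_mul (t ^ (-((K : ℤ) * ((K : ℤ) + 1) / 2)))
  refine le_of_tendsto_of_tendsto' hlg hlf ?_
  intro N
  rw [add_comm N, Finset.prod_range_add, norm_mul]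
  apply mul_le_mul (aux_first t ht0 K f hfirst)
  · rw [norm_prod]
    apply Finset.prod_le_prod
    · intro i _
      nlinarith [hp0 i, hp1 i]
    · intro i _
      exact hsecond i
  · apply Finset.prod_nonneg
    intro i _
    nlinarith [hp0 i, hp1 i]
  · exact norm_nonneg _
end
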